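/- Let k ≥ 2 and let S be an intersecting set of perfect matchings of K_{2k} with |S| = (2k-3)!!. Then the characteristic vector of S (as a vector in ℝ^{V}, where V is the set of all perfect matchings of K_{2k}) lies in the real linear span of the characteristic vectors of the canonical intersecting sets {S_e : e an edge of K_{2k}} (equivalently, in the column space of the perfect matching incidence matrix U). -/

import Mathlib

/-- A perfect matching of the complete graph `K_{2k}` on vertex set `Fin (2*k)`,
given as a finite set of edges: every edge is a non-loop, and every vertex lies
in exactly one edge of the matching. -/
def IsPM (k : ℕ) (M : Finset (Sym2 (Fin (2 * k)))) : Prop :=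
  (∀ e ∈ M, ¬ e.IsDiag) ∧ ∀ v : Fin (2 * k), ∃! e, e ∈ M ∧ v ∈ e

/-- The type of perfect matchings of `K_{2k}`. -/
abbrev PM (k : ℕ) : Type := {M : Finset (Sym2 (Fin (2 * k))) // IsPM k M}
open Equiv

/-- A perfect matching, seen as the fixed-point-free involution exchanging matched points. -/
structure IsMatchingPerm {V : Type*} (m : Perm V) : Prop where
  invol : ∀ x, m (m x) = x
  ne : ∀ x, m x ≠ x

/-- A one-factorization of the complete graph on `V`, with matchings indexed by colours `C`. -/
structure IsOneFactorization {V C : Type*} (F : C → Perm V) : Prop where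
  matching : ∀ c, IsMatchingPerm (F c)
  inj : ∀ c d x, F c x = F d x → c = d
  surj : ∀ x y, x ≠ y → ∃ c, F c x = y

namespace IsMatchingPerm
variable {V : Type*} {m : Perm V}

lemma conj (h : IsMatchingPerm m) (g : Perm V) : IsMatchingPerm (g * m * g⁻¹) where
  invol x := by simp [h.invol]
  ne x hx := h.ne (g⁻¹ x) (by
    rw [Perm.mul_apply, Perm.mul_apply] at hx
    exact Perm.eq_inv_iff_eq.2 hx)

variable [Fintype V] [DecidableEq V] {k : ℕ}

lemma cycleType_eq (hV : Fintype.card V = 2 * k) (h : IsMatchingPerm m) :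
    m.cycleType = Multiset.replicate k 2 := by
  rcases Nat.eq_zero_or_pos k with rfl | hk
  · have : IsEmpty V := Fintype.card_eq_zero_iff.1 (by simpa using hV)
    rw [Subsingleton.elim m 1]; simp
  have hne : Nonempty V := Fintype.card_pos_iff.1 (by omega)
  have hord : orderOf m = 2 := by
    refine orderOf_eq_prime (by ext x; simp [pow_two, h.invol]) fun h1 => ?_
    obtain ⟨x⟩ := hne
    exact h.ne x (by simp [h1])
  obtain ⟨n, hn⟩ := Perm.cycleType_prime_order (σ := m) (by rw [hord]; exact Nat.prime_two)
  have hsum := Perm.sum_cycleType m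
  have hsupp : m.support = Finset.univ := by ext x; simp [h.ne]
  rw [hsupp, Finset.card_univ, hV, hn, hord, Multiset.sum_replicate, smul_eq_mul] at hsum
  rw [hn, hord]
  congr 1
  omega

lemma of_cycleType (hV : Fintype.card V = 2 * k) (h : m.cycleType = Multiset.replicate k 2) :
    IsMatchingPerm m := by
  have hsq : m ^ 2 = 1 := by
    rw [← orderOf_dvd_iff_pow_eq_one, ← Perm.lcm_cycleType, h, Multiset.lcm_dvd]
    intro b hb
    rw [Multiset.eq_of_mem_replicate hb]
  refine ⟨fun x => ?_, fun x => ?_⟩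
  · simpa [pow_two] using congrArg (fun σ : Perm V => σ x) hsq
  · have hsum := Perm.sum_cycleType m
    rw [h, Multiset.sum_replicate, smul_eq_mul, mul_comm, ← hV] at hsum
    have := (Finset.card_eq_iff_eq_univ _).1 hsum.symm
    exact Perm.mem_support.1 (this ▸ Finset.mem_univ x)

lemma exists_conj (hV : Fintype.card V = 2 * k) {m' : Perm V} (h : IsMatchingPerm m)
    (h' : IsMatchingPerm m') : ∃ g : Perm V, g * m * g⁻¹ = m' :=
  isConj_iff.1 (Perm.isConj_iff_cycleType_eq.2 ((h.cycleType_eq hV).trans (h'.cycleType_eq hV).symm))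

end IsMatchingPerm

open Classical in
lemma card_isMatchingPerm {V : Type*} [Fintype V] {k : ℕ} (hV : Fintype.card V = 2 * k)
    (hk : 0 < k) :
    (Finset.univ.filter fun m : Perm V => IsMatchingPerm m).card =
      Nat.doubleFactorial (2 * k - 1) := by
  have heq : (Finset.univ.filter fun m : Perm V => IsMatchingPerm m) =
      Finset.univ.filter fun m : Perm V => m.cycleType = Multiset.replicate k 2 := by
    ext m
    simp only [Finset.mem_filter, Finset.mem_univ, true_and]
    exact ⟨fun h => h.cycleType_eq hV, IsMatchingPerm.of_cycleType hV⟩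
  have h := Perm.card_of_cycleType_mul_eq V (Multiset.replicate k 2)
  rw [if_pos ⟨by simp [hV, mul_comm], fun a ha => (Multiset.eq_of_mem_replicate ha).ge⟩,
    ← heq, hV, Multiset.toFinset_replicate, if_neg hk.ne'] at h
  simp only [Multiset.sum_replicate, Multiset.prod_replicate, smul_eq_mul,
    Finset.prod_singleton, Multiset.count_replicate_self, mul_comm k 2, Nat.sub_self,
    Nat.factorial_zero, one_mul] at h
  obtain ⟨j, rfl⟩ : ∃ j, k = j + 1 := ⟨k - 1, by omega⟩
  have h2 : (2 * (j + 1)).factorial = _ := Nat.factorial_eq_mul_doubleFactorial (2 * j + 1)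
  have h3 := Nat.doubleFactorial_two_mul (j + 1)
  rw [h2, show 2 * j + 1 + 1 = 2 * (j + 1) by ring, h3, mul_comm] at h
  exact Nat.eq_of_mul_eq_mul_left (by positivity) h

namespace IsOneFactorization
variable {V C : Type*} {F : C → Perm V}

lemma conj (h : IsOneFactorization F) (g : Perm V) :
    IsOneFactorization fun c => g * F c * g⁻¹ where
  matching c := (h.matching c).conj g
  inj c d x hx := h.inj c d (g⁻¹ x) (by simpa using hx)
  surj x y hxy := by
    obtain ⟨c, hc⟩ := h.surj (g⁻¹ x) (g⁻¹ y) (by simpa using hxy)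
    exact ⟨c, by rw [Perm.mul_apply, Perm.mul_apply, hc]; exact g.apply_symm_apply y⟩

lemma permCongr {V' : Type*} (h : IsOneFactorization F) (e : V ≃ V') :
    IsOneFactorization fun c => e.permCongr (F c) where
  matching c := ⟨fun x => by simp [(h.matching c).invol], fun x hx =>
    (h.matching c).ne (e.symm x) (by simpa [Equiv.permCongr_apply, ← Equiv.eq_symm_apply] using hx)⟩
  inj c d x hx := h.inj c d (e.symm x) (by simpa using hx)
  surj x y hxy := by
    obtain ⟨c, hc⟩ := h.surj (e.symm x) (e.symm y) (by simpa using hxy)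
    exact ⟨c, by simp [hc]⟩

end IsOneFactorization

/-- The partner function of the `c`-th round of the round-robin tournament. -/
def roundRobin {R : Type*} [CommRing R] [DecidableEq R] (c : R) : Option R → Option R
  | none => some c
  | some j => if j = c then none else some (2 * c - j)

lemma roundRobin_involutive {R : Type*} [CommRing R] [DecidableEq R] (c : R) :
    Function.Involutive (roundRobin c) := by
  rintro (_ | j)
  · simp [roundRobin]
  · by_cases h : j = c
    · simp [roundRobin, h]
    · have : 2 * c - j ≠ c := fun h' => h (by linear_combination -h')
      simp [roundRobin, h, this]

lemma isOneFactorization_roundRobin {R : Type*} [CommRing R] [DecidableEq R]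
    (h2 : IsUnit (2 : R)) :
    IsOneFactorization fun c : R => (roundRobin_involutive c).toPerm := by
  have hc : ∀ a b : R, 2 * a = 2 * b → a = b := fun a b => h2.mul_left_cancel
  refine ⟨fun c => ⟨roundRobin_involutive c, ?_⟩, ?_, ?_⟩
  · rintro (_ | j)
    · simp [roundRobin]
    · by_cases h : j = c
      · simp [roundRobin, h]
      · simp only [roundRobin, h, Function.Involutive.coe_toPerm, if_false, ne_eq, Option.some.injEq]
        exact fun h' => h (hc _ _ (by linear_combination -h'))
  · rintro c d (_ | j) h
    · simpa [roundRobin] using h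
    · simp only [roundRobin, Function.Involutive.coe_toPerm] at h
      split_ifs at h with h1 h2
      · exact h1.symm.trans h2
      · exact hc _ _ (by linear_combination Option.some.inj h)
  · rintro (_ | i) (_ | j) h
    · exact absurd rfl h
    · exact ⟨j, by simp [roundRobin]⟩
    · exact ⟨i, by simp [roundRobin]⟩
    · obtain ⟨t, ht⟩ := h2.exists_right_inv
      have hij : i ≠ j := fun h' => h (by rw [h'])
      have key : 2 * ((i + j) * t) = i + j := by linear_combination (i + j) * ht
      refine ⟨(i + j) * t, ?_⟩
      have hne : i ≠ (i + j) * t := fun h' => hij (by linear_combination 2 * h' + key)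
      simp only [roundRobin, Function.Involutive.coe_toPerm, if_neg hne, key]
      simp

lemma exists_isOneFactorization {V : Type*} [Fintype V] {k : ℕ} (hV : Fintype.card V = 2 * k)
    (hk : 0 < k) :
    ∃ F : ZMod (2 * k - 1) → Perm V, IsOneFactorization F := by
  have : NeZero (2 * k - 1) := ⟨by omega⟩
  have h2 : IsUnit (2 : ZMod (2 * k - 1)) := by
    have : Nat.Coprime 2 (2 * k - 1) := by
      rw [Nat.coprime_two_left]
      exact ⟨k - 1, by omega⟩
    exact_mod_cast (ZMod.isUnit_iff_coprime 2 (2 * k - 1)).2 this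
  have e : Option (ZMod (2 * k - 1)) ≃ V := Fintype.equivOfCardEq (by
    rw [Fintype.card_option, ZMod.card, hV]; omega)
  exact ⟨_, (isOneFactorization_roundRobin h2).permCongr e⟩

section CliqueCoclique
open Classical

variable {V C : Type*} [Fintype V] [Fintype C] {k : ℕ} {F : C → Perm V} {T : Finset (Perm V)}

lemma card_conj_eq_mul {m m' : Perm V} (hV : Fintype.card V = 2 * k) (hm : IsMatchingPerm m)
    (hm' : IsMatchingPerm m') :
    (Finset.univ.filter fun σ : Perm V => σ * m * σ⁻¹ = m').card *
      (Finset.univ.filter fun m : Perm V => IsMatchingPerm m).card = Fintype.card (Perm V) := by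
  rw [← Finset.card_univ, Finset.card_eq_sum_card_fiberwise (s := Finset.univ) (f := fun σ : Perm V => σ * m * σ⁻¹)
    (t := Finset.univ.filter fun m : Perm V => IsMatchingPerm m)
    (fun σ _ => by simpa using hm.conj σ), mul_comm, ← smul_eq_mul, ← Finset.sum_const]
  refine Finset.sum_congr rfl fun m'' hm'' => ?_
  obtain ⟨g, rfl⟩ := hm'.exists_conj hV (Finset.mem_filter.1 hm'').2
  refine Finset.card_bij (fun σ _ => g * σ) ?_ (fun _ _ _ _ h => mul_left_cancel h) ?_
  · simp only [Finset.mem_filter, Finset.mem_univ, true_and]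
    rintro σ rfl
    group
  · simp only [Finset.mem_filter, Finset.mem_univ, true_and]
    intro τ hτ
    refine ⟨g⁻¹ * τ, ?_, by group⟩
    rw [mul_inv_rev, inv_inv]
    calc g⁻¹ * τ * m * (τ⁻¹ * g) = g⁻¹ * (τ * m * τ⁻¹) * g := by group
      _ = m' := by rw [hτ]; group

namespace IsOneFactorization

lemma card_filter_le_one [Nonempty V] (hF : IsOneFactorization F)
    (hT : ∀ m ∈ T, ∀ n ∈ T, ∃ x, m x = n x) :
    (Finset.univ.filter fun c => F c ∈ T).card ≤ 1 := by
  rw [Finset.card_le_one]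
  intro c hc d hd
  obtain ⟨x, hx⟩ := hT _ (Finset.mem_filter.1 hc).2 _ (Finset.mem_filter.1 hd).2
  exact hF.inj _ _ _ hx

lemma sum_card_conj_mul (hV : Fintype.card V = 2 * k) (hF : IsOneFactorization F)
    (hT : ∀ m ∈ T, IsMatchingPerm m) :
    (∑ σ : Perm V, (Finset.univ.filter fun c => σ * F c * σ⁻¹ ∈ T).card) *
      (Finset.univ.filter fun m : Perm V => IsMatchingPerm m).card =
      Fintype.card C * T.card * Fintype.card (Perm V) := by
  have h1 : ∀ c, (Finset.univ.filter fun σ : Perm V => σ * F c * σ⁻¹ ∈ T).card *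
      (Finset.univ.filter fun m : Perm V => IsMatchingPerm m).card =
        T.card * Fintype.card (Perm V) := by
    intro c
    rw [Finset.card_eq_sum_card_fiberwise
      (s := Finset.univ.filter fun σ : Perm V => σ * F c * σ⁻¹ ∈ T) (f := fun σ : Perm V => σ * F c * σ⁻¹) (t := T)
      (fun σ hσ => (Finset.mem_filter.1 hσ).2), Finset.sum_mul, ← smul_eq_mul,
      ← Finset.sum_const]
    refine Finset.sum_congr rfl fun m hm => ?_
    rw [← card_conj_eq_mul hV (hF.matching c) (hT m hm)]
    congr 2
    ext σ
    simp only [Finset.mem_filter, Finset.mem_univ, true_and, and_iff_right_iff_imp]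
    rintro rfl
    exact hm
  have h2 : ∑ σ : Perm V, (Finset.univ.filter fun c => σ * F c * σ⁻¹ ∈ T).card =
      ∑ c, (Finset.univ.filter fun σ : Perm V => σ * F c * σ⁻¹ ∈ T).card := by
    simp only [Finset.card_filter]
    exact Finset.sum_comm
  rw [h2, Finset.sum_mul, Finset.sum_congr rfl fun c _ => h1 c, Finset.sum_const, smul_eq_mul,
    Finset.card_univ, mul_assoc]

lemma card_mul_card_le [Nonempty V] (hV : Fintype.card V = 2 * k) (hF : IsOneFactorization F)
    (hT : ∀ m ∈ T, IsMatchingPerm m) (hint : ∀ m ∈ T, ∀ n ∈ T, ∃ x, m x = n x) :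
    Fintype.card C * T.card ≤ (Finset.univ.filter fun m : Perm V => IsMatchingPerm m).card := by
  refine Nat.le_of_mul_le_mul_right ?_ (Fintype.card_pos (α := Perm V))
  rw [← hF.sum_card_conj_mul hV hT, mul_comm]
  refine Nat.mul_le_mul_left _ ?_
  calc _ ≤ ∑ _σ : Perm V, 1 :=
        Finset.sum_le_sum fun σ _ => (hF.conj σ).card_filter_le_one hint
    _ = _ := by simp

lemma exists_mem_of_card_mul_card_eq [Nonempty V] (hV : Fintype.card V = 2 * k)
    (hF : IsOneFactorization F)
    (hT : ∀ m ∈ T, IsMatchingPerm m) (hint : ∀ m ∈ T, ∀ n ∈ T, ∃ x, m x = n x)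
    (hcard : Fintype.card C * T.card =
      (Finset.univ.filter fun m : Perm V => IsMatchingPerm m).card) (hpos : T.Nonempty) :
    ∃ c, F c ∈ T := by
  have h := hF.sum_card_conj_mul hV hT
  obtain ⟨m, hm⟩ := hpos
  have hN : 0 < (Finset.univ.filter fun m : Perm V => IsMatchingPerm m).card :=
    Finset.card_pos.2 ⟨m, by simpa using hT m hm⟩
  rw [hcard, mul_comm] at h
  replace h : _ = ∑ _σ : Perm V, 1 := (Nat.eq_of_mul_eq_mul_left hN h).trans (by simp)
  have := (Finset.sum_eq_sum_iff_of_le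
    fun σ _ => (hF.conj σ).card_filter_le_one hint).1 h 1 (Finset.mem_univ _)
  obtain ⟨c, hc⟩ := Finset.card_pos.1 (this ▸ Nat.one_pos)
  exact ⟨c, by simpa using hc⟩

end IsOneFactorization
end CliqueCoclique

section Averaging
open Classical

variable {V : Type*} {ν : Perm V}

lemma IsMatchingPerm.exists_commute (hν : IsMatchingPerm ν) (b c : V) :
    ∃ τ : Perm V, τ b = c ∧ (∀ z, τ (ν z) = ν (τ z)) ∧
      ∀ z, z ≠ b → z ≠ c → ν z ≠ b → ν z ≠ c → τ z = z := by
  have h1 := hν.invol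
  have h2 := hν.ne
  by_cases hbc : c = ν b
  · refine ⟨swap b (ν b), by simp [hbc], ?_, ?_⟩
    · intro z
      simp only [swap_apply_def]
      grind
    · intro z
      simp only [swap_apply_def]
      grind
  · refine ⟨swap b c * swap (ν b) (ν c), ?_, ?_, ?_⟩
    · simp only [Perm.mul_apply, swap_apply_def]
      grind
    · intro z
      simp only [Perm.mul_apply, swap_apply_def]
      grind
    · intro z
      simp only [Perm.mul_apply, swap_apply_def]
      grind

variable {u x : V}

lemma card_four (hν : IsMatchingPerm ν) (hux : x ≠ u) (hux' : x ≠ ν u) :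
    ({u, ν u, x, ν x} : Finset V).card = 4 := by
  have h1 := hν.invol
  have h2 := hν.ne
  rw [Finset.card_eq_succ]
  refine ⟨u, {ν u, x, ν x}, ?_, rfl, Finset.card_eq_three.2 ⟨_, _, _, ?_, ?_, ?_, rfl⟩⟩ <;> grind

variable [Fintype V]

/-- The permutations which preserve the matching `ν` and fix the points `u` and `x`. -/
noncomputable def matchingStabilizer (ν : Perm V) (u x : V) : Finset (Perm V) :=
  Finset.univ.filter fun σ => (∀ z, σ (ν z) = ν (σ z)) ∧ σ u = u ∧ σ x = x

/-- The number of `σ` in the stabilizer for which `f` maps `σ z` to `σ w`. -/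
noncomputable def stabilizerCount (ν : Perm V) (u x : V) (f : Perm V) (z w : V) : ℕ :=
  ((matchingStabilizer ν u x).filter fun σ => f (σ z) = σ w).card

variable {f : Perm V} {z w : V}

lemma mem_matchingStabilizer {σ : Perm V} : σ ∈ matchingStabilizer ν u x ↔
    (∀ z, σ (ν z) = ν (σ z)) ∧ σ u = u ∧ σ x = x := by
  simp [matchingStabilizer]

lemma stabilizerCount_apply {τ : Perm V} (hτ : τ ∈ matchingStabilizer ν u x) :
    stabilizerCount ν u x f (τ z) (τ w) = stabilizerCount ν u x f z w := by
  rw [mem_matchingStabilizer] at hτ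
  refine Finset.card_bij (fun σ _ => σ * τ) ?_ (fun _ _ _ _ h => mul_right_cancel h) ?_
  · simp +contextual [mem_matchingStabilizer, hτ]
  · intro σ hσ
    simp only [Finset.mem_filter, mem_matchingStabilizer] at hσ
    refine ⟨σ * τ⁻¹, ?_, by group⟩
    have h1 : ∀ z, τ⁻¹ (ν z) = ν (τ⁻¹ z) := fun z => by
      rw [Perm.inv_eq_iff_eq, hτ.1]
      exact congrArg ν (τ.apply_symm_apply z).symm
    have h2 : τ⁻¹ u = u := by rw [Perm.inv_eq_iff_eq, hτ.2.1]
    have h3 : τ⁻¹ x = x := by rw [Perm.inv_eq_iff_eq, hτ.2.2]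
    have h4 : ∀ z, τ⁻¹ (τ z) = z := τ.symm_apply_apply
    simp only [Finset.mem_filter, mem_matchingStabilizer, Perm.mul_apply, h1, h2, h3, h4]
    exact ⟨⟨fun z => hσ.1.1 _, hσ.1.2⟩, hσ.2⟩

lemma card_mul_stabilizerCount (T : Finset V)
    (h : ∀ c ∈ T, stabilizerCount ν u x f z c = stabilizerCount ν u x f z w) :
    T.card * stabilizerCount ν u x f z w =
      ((matchingStabilizer ν u x).filter fun σ => σ⁻¹ (f (σ z)) ∈ T).card := by
  rw [Finset.card_eq_sum_card_fiberwise
      (s := (matchingStabilizer ν u x).filter fun σ => σ⁻¹ (f (σ z)) ∈ T) (f := fun σ : Perm V => σ⁻¹ (f (σ z))) (t := T)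
      (fun σ hσ => (Finset.mem_filter.1 hσ).2), ← smul_eq_mul, ← Finset.sum_const]
  refine Finset.sum_congr rfl fun c hc => ?_
  rw [← h c hc, stabilizerCount, Finset.filter_filter]
  congr 1
  ext σ
  simp only [Finset.mem_filter, Perm.inv_eq_iff_eq]
  constructor
  · rintro ⟨h1, h2⟩
    exact ⟨h1, by rw [h2]; simpa using hc, h2⟩
  · rintro ⟨h1, -, h2⟩
    exact ⟨h1, h2⟩

lemma exists_mem_stabilizer (hν : IsMatchingPerm ν) {b c : V} (hb : b ∉ ({u, ν u, x, ν x} : Finset V))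
    (hc : c ∉ ({u, ν u, x, ν x} : Finset V)) :
    ∃ τ ∈ matchingStabilizer ν u x, τ b = c ∧
      ∀ z, z ≠ b → z ≠ c → ν z ≠ b → ν z ≠ c → τ z = z := by
  obtain ⟨τ, h1, h2, h3⟩ := hν.exists_commute b c
  simp only [Finset.mem_insert, Finset.mem_singleton, not_or] at hb hc
  refine ⟨τ, mem_matchingStabilizer.2 ⟨h2, ?_, ?_⟩, h1, h3⟩ <;> apply h3 <;> grind

/-- For points away from the two distinguished edges, only few permutations of the stabilizer
make `f` join them. -/
lemma stabilizerCount_generic (hν : IsMatchingPerm ν) (hux : x ≠ u) (hux' : x ≠ ν u)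
    (hz : z ∉ ({u, ν u, x, ν x} : Finset V)) (hw : w ∉ ({u, ν u, x, ν x} : Finset V))
    (hzw : z ≠ w) (hzw' : w ≠ ν z) {r : ℕ} (hr : Fintype.card V = r + 6) :
    r * stabilizerCount ν u x f z w ≤ ((matchingStabilizer ν u x).filter fun σ =>
      f (σ z) ∉ ({u, ν u, x, ν x} : Finset V)).card := by
  have h1 := hν.invol
  have h2 := hν.ne
  have hcard : (insert z (insert (ν z) ({u, ν u, x, ν x} : Finset V)))ᶜ.card = r := by
    have hz' : ν z ∉ ({u, ν u, x, ν x} : Finset V) := by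
      simp only [Finset.mem_insert, Finset.mem_singleton, not_or] at hz ⊢; grind
    rw [Finset.card_compl, Finset.card_insert_of_notMem, Finset.card_insert_of_notMem hz',
      card_four hν hux hux', hr]
    · omega
    · rw [Finset.mem_insert, not_or]
      exact ⟨(h2 z).symm, hz⟩
  rw [← hcard, card_mul_stabilizerCount]
  · refine Finset.card_le_card fun σ hσ => ?_
    simp only [Finset.mem_filter, mem_matchingStabilizer, Finset.mem_compl, Finset.mem_insert,
      Finset.mem_singleton, not_or, Perm.inv_eq_iff_eq, ← ne_eq] at hσ ⊢
    grind
  · intro c hc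
    rw [Finset.mem_compl, Finset.mem_insert, Finset.mem_insert, not_or, not_or] at hc
    obtain ⟨τ, hτ, hτc, hτ'⟩ := exists_mem_stabilizer hν hw hc.2.2
    have hz0 : τ z = z := hτ' z hzw (Ne.symm hc.1) hzw'.symm (Ne.symm hc.2.1)
    rw [← stabilizerCount_apply hτ (z := z) (w := w), hz0, hτc]

/-- Few permutations of the stabilizer make `f` join a point of a distinguished edge to a point
away from both. -/
lemma stabilizerCount_special (hν : IsMatchingPerm ν) (hux : x ≠ u) (hux' : x ≠ ν u)
    (hz : z = x ∨ z = ν x) (hw : w ∉ ({u, ν u, x, ν x} : Finset V))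
    {r : ℕ} (hr : Fintype.card V = r + 6) :
    (r + 2) * stabilizerCount ν u x f z w ≤ (matchingStabilizer ν u x).card := by
  have h1 := hν.invol
  have hcard : ({u, ν u, x, ν x} : Finset V)ᶜ.card = r + 2 := by
    rw [Finset.card_compl, card_four hν hux hux', hr]
    omega
  rw [← hcard, card_mul_stabilizerCount]
  · exact Finset.card_le_card (Finset.filter_subset _ _)
  · intro c hc
    rw [Finset.mem_compl] at hc
    obtain ⟨τ, hτ, hτc, -⟩ := exists_mem_stabilizer hν hw hc
    have hz0 : τ z = z := by
      rw [mem_matchingStabilizer] at hτ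
      rcases hz with rfl | rfl
      · exact hτ.2.2
      · rw [hτ.1, hτ.2.2]
    rw [← stabilizerCount_apply hτ (z := z) (w := w), hz0, hτc]

end Averaging
section Avoiding
open Classical

variable {V : Type*} [Fintype V] {ν M f g : Perm V} {u x z : V}

/-- The number of `σ` in the stabilizer such that `f` or `g` joins `σ z` to `σ (M z)`. -/
noncomputable def clashCount (ν : Perm V) (u x : V) (f g M : Perm V) (z : V) : ℕ :=
  ((matchingStabilizer ν u x).filter fun σ => f (σ z) = σ (M z) ∨ g (σ z) = σ (M z)).card

lemma clashCount_le :
    clashCount ν u x f g M z ≤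
      stabilizerCount ν u x f z (M z) + stabilizerCount ν u x g z (M z) := by
  rw [clashCount, Finset.filter_or]
  exact Finset.card_union_le _ _

lemma clashCount_self : clashCount ν u x f f M z = stabilizerCount ν u x f z (M z) := by
  simp only [clashCount, or_self]; rfl

lemma one_mem_matchingStabilizer : (1 : Perm V) ∈ matchingStabilizer ν u x := by
  simp [mem_matchingStabilizer]

lemma card_matchingStabilizer_pos : 0 < (matchingStabilizer ν u x).card :=
  Finset.card_pos.2 ⟨1, one_mem_matchingStabilizer⟩

lemma clashCount_apply (hM : IsMatchingPerm M) (hf : IsMatchingPerm f) (hg : IsMatchingPerm g) :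
    clashCount ν u x f g M (M z) = clashCount ν u x f g M z := by
  unfold clashCount
  congr 1
  ext σ
  simp only [Finset.mem_filter, and_congr_right_iff, hM.invol]
  intro _
  have h1 := hf.invol
  have h2 := hg.invol
  grind

lemma clashCount_special (hν : IsMatchingPerm ν) (hux : x ≠ u) (hux' : x ≠ ν u)
    (hM : IsMatchingPerm M) (hMu : M u = ν u)
    (hf : IsMatchingPerm f) (hg : IsMatchingPerm g) (hfu : f u = x) (hgu : g (ν u) = ν x)
    {r : ℕ} (hr : Fintype.card V = r + 6) (hMx : M x ≠ ν x) (hz : z = x ∨ z = ν x) :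
    r * clashCount ν u x f g M z < (matchingStabilizer ν u x).card := by
  have n1 := hν.invol
  have n2 := hν.ne
  have m1 := hM.invol
  have m2 := hM.ne
  have f1 := hf.invol
  have g1 := hg.invol
  have hw : M z ∉ ({u, ν u, x, ν x} : Finset V) := by
    simp only [Finset.mem_insert, Finset.mem_singleton, not_or]
    grind
  have hpos : 0 < (matchingStabilizer ν u x).card := card_matchingStabilizer_pos
  have key : ∀ h : Perm V, r * stabilizerCount ν u x h z (M z) < (matchingStabilizer ν u x).card := by
    intro h
    have := stabilizerCount_special (f := h) hν hux hux' hz hw hr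
    rcases Nat.eq_zero_or_pos (stabilizerCount ν u x h z (M z)) with h0 | h0
    · rw [h0]; simpa using hpos
    · nlinarith
  have hzero : ∃ h, clashCount ν u x f g M z ≤ stabilizerCount ν u x h z (M z) := by
    rcases hz with rfl | rfl
    · refine ⟨g, Finset.card_le_card fun σ hσ => ?_⟩
      simp only [Finset.mem_filter, mem_matchingStabilizer] at hσ ⊢
      refine ⟨hσ.1, hσ.2.resolve_left fun h => ?_⟩
      have : σ (M z) = σ u := by rw [← h, hσ.1.2.2, hσ.1.2.1, ← hfu, f1]
      have := σ.injective this
      grind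
    · refine ⟨f, Finset.card_le_card fun σ hσ => ?_⟩
      simp only [Finset.mem_filter, mem_matchingStabilizer] at hσ ⊢
      refine ⟨hσ.1, hσ.2.resolve_right fun h => ?_⟩
      have : σ (M (ν x)) = σ (ν u) := by
        rw [← h, hσ.1.1, hσ.1.1, hσ.1.2.2, hσ.1.2.1, ← hgu, g1]
      have := σ.injective this
      grind
  obtain ⟨h, hh⟩ := hzero
  exact (Nat.mul_le_mul_left r hh).trans_lt (key h)

lemma clashCount_generic (hν : IsMatchingPerm ν) (hux : x ≠ u) (hux' : x ≠ ν u)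
    (hf : IsMatchingPerm f) (hfu : f u = x) (hgu : g (ν u) = ν x)
    (hfg : f = g ∨ ∀ z, f z ≠ g z) (hfν : ∀ z, f z ≠ ν z)
    (hM : IsMatchingPerm M)
    {r : ℕ} (hr : Fintype.card V = r + 6) (hMz : M z ≠ ν z)
    (hz : z ∉ ({u, ν u, x, ν x} : Finset V)) (hw : M z ∉ ({u, ν u, x, ν x} : Finset V)) :
    r * clashCount ν u x f g M z < 2 * (matchingStabilizer ν u x).card := by
  have hpos : 0 < (matchingStabilizer ν u x).card := card_matchingStabilizer_pos
  have key := fun h : Perm V =>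
    stabilizerCount_generic (f := h) hν hux hux' hz hw (hM.ne z).symm hMz hr
  have key' := fun h : Perm V => (key h).trans (Finset.card_le_card (Finset.filter_subset _ _))
  rcases hfg with rfl | hfg
  · rw [clashCount_self]
    have := key' f
    omega
  · have hstrict : r * stabilizerCount ν u x f z (M z) < (matchingStabilizer ν u x).card := by
      refine (key f).trans_lt (Finset.card_lt_card (Finset.filter_ssubset.2 ?_))
      have hw' : f (ν u) ∉ ({u, ν u, x, ν x} : Finset V) := by
        have n1 := hν.invol
        have n2 := hν.ne
        have f1 := hf.invol
        have f2 := hf.ne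
        have := hfg (ν u)
        simp only [Finset.mem_insert, Finset.mem_singleton, not_or]
        grind
      obtain ⟨τ, hτ, hτz, -⟩ := exists_mem_stabilizer hν hz hw'
      exact ⟨τ, hτ, by simp [hτz, hf.invol]⟩
    calc r * clashCount ν u x f g M z
        ≤ r * stabilizerCount ν u x f z (M z) + r * stabilizerCount ν u x g z (M z) := by
          rw [← mul_add]; exact Nat.mul_le_mul_left _ clashCount_le
      _ < _ := by have := key' g; omega

lemma two_mul_card_le_sum_clashCount (hM : IsMatchingPerm M) (hf : IsMatchingPerm f)
    (hg : IsMatchingPerm g) (hν : IsMatchingPerm ν)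
    (hfν : ∀ z, f z ≠ ν z) (hgν : ∀ z, g z ≠ ν z)
    (h : ∀ σ ∈ matchingStabilizer ν u x, ∃ z, f (σ z) = σ (M z) ∨ g (σ z) = σ (M z)) :
    2 * (matchingStabilizer ν u x).card ≤
      ∑ z ∈ Finset.univ.filter (fun z => M z ≠ ν z), clashCount ν u x f g M z := by
  have hsum := Finset.sum_card_bipartiteAbove_eq_sum_card_bipartiteBelow
    (s := matchingStabilizer ν u x) (t := Finset.univ.filter fun z => M z ≠ ν z)
    (fun σ z => f (σ z) = σ (M z) ∨ g (σ z) = σ (M z))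
  simp only [Finset.bipartiteAbove, Finset.bipartiteBelow] at hsum
  unfold clashCount
  rw [← hsum, mul_comm, ← smul_eq_mul, ← Finset.sum_const]
  refine Finset.sum_le_sum fun σ hσ => ?_
  obtain ⟨z, hz⟩ := h σ hσ
  rw [mem_matchingStabilizer] at hσ
  have n1 := hν.invol
  have m1 := hM.invol
  have f1 := hf.invol
  have g1 := hg.invol
  rw [← Finset.card_pair (hM.ne z).symm]
  refine Finset.card_le_card fun w hw => ?_
  have hMz : M z ≠ ν z := by
    intro h0
    rw [h0, hσ.1] at hz
    exact hz.elim (hfν _) (hgν _)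
  simp only [Finset.mem_insert, Finset.mem_singleton, Finset.mem_filter, Finset.mem_univ,
    true_and] at hw ⊢
  rcases hw with rfl | rfl
  · exact ⟨hMz, hz⟩
  · rw [m1]
    refine ⟨?_, ?_⟩ <;> grind

/-- Two matchings `f` and `g`, disjoint from `ν`, can be moved off `M` by a permutation
stabilizing `ν`, provided `M` shares enough edges with `ν`. -/
lemma exists_avoiding (hν : IsMatchingPerm ν) (hux : x ≠ u) (hux' : x ≠ ν u)
    (hM : IsMatchingPerm M) (hMu : M u = ν u) {a : V} (hMa : M a = ν a)
    (ha : a ∉ ({u, ν u, x, ν x} : Finset V))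
    (hf : IsMatchingPerm f) (hg : IsMatchingPerm g) (hfu : f u = x) (hgu : g (ν u) = ν x)
    (hfg : f = g ∨ ∀ z, f z ≠ g z) (hfν : ∀ z, f z ≠ ν z) (hgν : ∀ z, g z ≠ ν z) :
    ∃ σ ∈ matchingStabilizer ν u x, ∀ z, f (σ z) ≠ σ (M z) ∧ g (σ z) ≠ σ (M z) := by
  by_contra! hcon
  have hsum := two_mul_card_le_sum_clashCount hM hf hg hν hfν hgν (u := u) (x := x) fun σ hσ => by
    obtain ⟨z, hz⟩ := hcon σ hσ
    exact ⟨z, or_iff_not_imp_left.2 hz⟩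
  have n1 := hν.invol
  have n2 := hν.ne
  have m1 := hM.invol
  have m2 := hM.ne
  have hpos : 0 < (matchingStabilizer ν u x).card := card_matchingStabilizer_pos
  set b := clashCount ν u x f g M with hb
  set G := (matchingStabilizer ν u x).card with hG
  set Z := Finset.univ.filter (fun z => M z ≠ ν z) with hZ
  have hfour := card_four hν hux hux'
  have ha' : ν a ∉ ({u, ν u, x, ν x} : Finset V) := by
    simp only [Finset.mem_insert, Finset.mem_singleton, not_or] at ha ⊢; grind
  have hsix : (insert a (insert (ν a) ({u, ν u, x, ν x} : Finset V))).card = 6 := by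
    rw [Finset.card_insert_of_notMem, Finset.card_insert_of_notMem ha', hfour]
    rw [Finset.mem_insert, not_or]
    exact ⟨(n2 a).symm, ha⟩
  obtain ⟨r, hr⟩ : ∃ r, Fintype.card V = r + 6 :=
    ⟨Fintype.card V - 6, by have := Finset.card_le_univ (α := V) _ |>.trans' hsix.ge; omega⟩
  have hsum' : r * (2 * G) ≤ ∑ z ∈ Z, r * b z := by
    rw [← Finset.mul_sum]; exact Nat.mul_le_mul_left _ hsum
  have hgen : ∀ z ∈ Z, z ≠ x → z ≠ ν x → M z ≠ x → M z ≠ ν x → r * b z < 2 * G := by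
    intro z hz h1 h2 h3 h4
    have hz := (Finset.mem_filter.1 hz).2
    refine clashCount_generic hν hux hux' hf hfu hgu hfg hfν hM hr hz ?_ ?_ <;>
    · simp only [Finset.mem_insert, Finset.mem_singleton, not_or]; grind
  by_cases hMx : M x = ν x
  · have hlt : ∀ z ∈ Z, r * b z < 2 * G := by
      intro z hz
      have hz' := (Finset.mem_filter.1 hz).2
      apply hgen z hz <;> grind
    have hZr : Z.card ≤ r := by
      have : Z ⊆ (insert a (insert (ν a) ({u, ν u, x, ν x} : Finset V)))ᶜ := by
        intro z hz
        have hz' := (Finset.mem_filter.1 hz).2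
        simp only [Finset.mem_compl, Finset.mem_insert, Finset.mem_singleton, not_or]
        grind
      have := Finset.card_le_card this
      rw [Finset.card_compl] at this
      omega
    have hne : Z.Nonempty := by
      rw [Finset.nonempty_iff_ne_empty]
      intro h0
      rw [h0, Finset.sum_empty] at hsum
      omega
    have h1 := Finset.sum_lt_sum_of_nonempty hne hlt
    rw [Finset.sum_const, smul_eq_mul] at h1
    have := Nat.mul_le_mul_right (2 * G) hZr
    omega
  · set E : Finset V := {x, ν x, M x, M (ν x)} with hE
    have hMνx : M (ν x) ≠ x := by grind
    have hEcard : E.card = 4 := by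
      rw [Finset.card_eq_succ]
      refine ⟨x, {ν x, M x, M (ν x)}, ?_, rfl, Finset.card_eq_three.2 ⟨_, _, _, ?_, ?_, ?_, rfl⟩⟩
      · simp only [Finset.mem_insert, Finset.mem_singleton, not_or]; grind
      all_goals grind
    have hEZ : E ⊆ Z := by
      intro z hz
      simp only [hE, Finset.mem_insert, Finset.mem_singleton] at hz
      simp only [hZ, Finset.mem_filter, Finset.mem_univ, true_and]
      grind
    have hEb : ∀ z ∈ E, r * b z ≤ G := by
      intro z hz
      have key := fun y hy =>
        (clashCount_special (z := y) hν hux hux' hM hMu hf hg hfu hgu hr hMx hy).le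
      simp only [hE, Finset.mem_insert, Finset.mem_singleton] at hz
      rcases hz with rfl | rfl | rfl | rfl
      · exact key _ (Or.inl rfl)
      · exact key _ (Or.inr rfl)
      · rw [hb, clashCount_apply hM hf hg]; exact key _ (Or.inl rfl)
      · rw [hb, clashCount_apply hM hf hg]; exact key _ (Or.inr rfl)
    have hEb' : r * b x < G :=
      clashCount_special hν hux hux' hM hMu hf hg hfu hgu hr hMx (Or.inl rfl)
    have hZr : Z.card ≤ r + 2 := by
      have h4 : ({u, ν u, a, ν a} : Finset V).card = 4 := by
        simp only [Finset.mem_insert, Finset.mem_singleton, not_or] at ha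
        exact card_four hν ha.1 ha.2.1
      have : Z ⊆ ({u, ν u, a, ν a} : Finset V)ᶜ := by
        intro z hz
        have hz' := (Finset.mem_filter.1 hz).2
        simp only [Finset.mem_compl, Finset.mem_insert, Finset.mem_singleton, not_or]
        grind
      have := Finset.card_le_card this
      rw [Finset.card_compl, h4] at this
      omega
    have hsplit := Finset.sum_sdiff hEZ (f := fun z => r * b z)
    have h1 : ∑ z ∈ E, r * b z < E.card * G := by
      rw [← smul_eq_mul, ← Finset.sum_const]
      exact Finset.sum_lt_sum hEb ⟨x, by simp [hE], hEb'⟩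
    have h2 : ∑ z ∈ Z \ E, r * b z ≤ (Z \ E).card * (2 * G) := by
      rw [← smul_eq_mul, ← Finset.sum_const]
      refine Finset.sum_le_sum fun z hz => (hgen z (Finset.mem_sdiff.1 hz).1 ?_ ?_ ?_ ?_).le <;>
      · have := (Finset.mem_sdiff.1 hz).2
        simp only [hE, Finset.mem_insert, Finset.mem_singleton, not_or] at this
        grind
    have h3 : (Z \ E).card + 4 ≤ r + 2 := by
      have := Finset.card_sdiff_add_card_eq_card hEZ
      omega
    rw [hEcard] at h1
    nlinarith

end Avoiding
section Extremal
open Classical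

variable {V : Type*} [Fintype V] {k : ℕ} {S : Finset (Perm V)}

/-- Forcing an edge of `M` into `N` does not leave an extremal intersecting family. -/
lemma swap_conj_mem (hV : Fintype.card V = 2 * k) (hk : 0 < k)
    (hS : ∀ m ∈ S, IsMatchingPerm m) (hint : ∀ m ∈ S, ∀ n ∈ S, ∃ x, m x = n x)
    (hmeet : ∀ F : ZMod (2 * k - 1) → Perm V, IsOneFactorization F → ∃ c, F c ∈ S)
    {M N : Perm V} (hM : M ∈ S) (hN : N ∈ S) {u : V} (hu : M u ≠ N u) :
    swap (M u) (N u) * N * (swap (M u) (N u))⁻¹ ∈ S := by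
  have hNm := hS N hN
  have hMm := hS M hM
  have m1 := hMm.invol
  have m2 := hMm.ne
  have p1 := hNm.invol
  have p2 := hNm.ne
  have hν : IsMatchingPerm (swap (M u) (N u) * N * (swap (M u) (N u))⁻¹) := hNm.conj _
  have hνapp : ∀ z, (swap (M u) (N u) * N * (swap (M u) (N u))⁻¹) z =
      swap (M u) (N u) (N (swap (M u) (N u) z)) := fun z => by simp [swap_inv]
  generalize swap (M u) (N u) * N * (swap (M u) (N u))⁻¹ = ν at hν hνapp ⊢
  have n1 := hν.invol
  have n2 := hν.ne
  have hνu : ν u = M u := by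
    rw [hνapp, swap_apply_of_ne_of_ne (m2 u).symm (p2 u).symm, swap_apply_right]
  have hνx : ν (N u) = N (M u) := by
    rw [hνapp, swap_apply_right, swap_apply_of_ne_of_ne] <;> grind
  have hνz : ∀ z, z ≠ u → z ≠ M u → z ≠ N u → z ≠ N (M u) → ν z = N z := by
    intro z h1 h2 h3 h4
    rw [hνapp, swap_apply_of_ne_of_ne h2 h3, swap_apply_of_ne_of_ne] <;> grind
  have hux : N u ≠ u := p2 u
  have hux' : N u ≠ ν u := by rw [hνu]; exact hu.symm
  obtain ⟨F₀, hF₀⟩ := exists_isOneFactorization hV hk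
  obtain ⟨g, hg⟩ := (hF₀.matching 0).exists_conj hV hν
  have hF := hF₀.conj g
  generalize hFdef : (fun c => g * F₀ c * g⁻¹) = F at hF
  have hF0 : F 0 = ν := by rw [← hFdef, ← hg]
  obtain ⟨p, hp⟩ := hF.surj u (N u) hux.symm
  obtain ⟨q, hq⟩ := hF.surj (ν u) (ν (N u)) (by simpa using hux.symm)
  obtain ⟨a, ha⟩ := hint M hM N hN
  have haW : a ∉ ({u, ν u, N u, ν (N u)} : Finset V) := by
    simp only [Finset.mem_insert, Finset.mem_singleton, not_or, hνu, hνx]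
    grind
  have hMa : M a = ν a := by
    simp only [Finset.mem_insert, Finset.mem_singleton, not_or, hνu, hνx] at haW
    rw [ha, hνz] <;> grind
  have hne : ∀ c, c ≠ 0 → ∀ z, F c z ≠ ν z := fun c hc z h => hc (hF.inj c 0 z (by rw [h, hF0]))
  have hp0 : p ≠ 0 := by
    rintro rfl
    rw [hF0] at hp
    exact hux' hp.symm
  have hq0 : q ≠ 0 := by
    rintro rfl
    rw [hF0, n1, hνx] at hq
    grind
  obtain ⟨σ, hσ, hσM⟩ := exists_avoiding hν hux hux' hMm hνu.symm hMa haW (hF.matching p)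
    (hF.matching q) hp hq (by
      by_cases hpq : p = q
      · exact Or.inl (by rw [hpq])
      · exact Or.inr fun z h => hpq (hF.inj p q z h)) (hne p hp0) (hne q hq0)
  obtain ⟨hσν, hσu, hσx⟩ := mem_matchingStabilizer.1 hσ
  have happ : ∀ c z w, (σ⁻¹ * F c * σ⁻¹⁻¹) z = w ↔ F c (σ z) = σ w := by
    intro c z w
    rw [Perm.mul_apply, Perm.mul_apply, Perm.inv_eq_iff_eq, inv_inv]
  obtain ⟨c, hc⟩ := hmeet _ (hF.conj σ⁻¹)
  by_cases hc0 : c = 0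
  · have : σ⁻¹ * F c * σ⁻¹⁻¹ = ν := by
      ext z
      rw [happ, hc0, hF0, hσν]
    rwa [this] at hc
  · exfalso
    obtain ⟨w, hw⟩ := hint _ hc M hM
    rw [happ] at hw
    have hcp : c ≠ p := fun h => (hσM w).1 (h ▸ hw)
    have hcq : c ≠ q := fun h => (hσM w).2 (h ▸ hw)
    have hcu : F c u ≠ N u := fun h => hcp (hF.inj c p u (h.trans hp.symm))
    have hcv : F c (ν u) ≠ ν (N u) := fun h => hcq (hF.inj c q _ (h.trans hq.symm))
    have hinv := (hF.matching c).invol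
    obtain ⟨z, hz⟩ := hint _ hc N hN
    rw [happ] at hz
    have hzν : ν z ≠ N z := by
      intro h
      rw [← h, hσν] at hz
      exact hne c hc0 _ hz
    have hσv : σ (M u) = M u := by rw [← hνu, hσν, hσu]
    have hσy : σ (N (M u)) = N (M u) := by rw [← hνx, hσν, hσx]
    rw [hνu, hνx] at hcv
    by_cases h1 : z = u
    · rw [h1, hσu, hσx] at hz
      exact hcu hz
    by_cases h2 : z = M u
    · rw [h2, hσv, hσy] at hz
      exact hcv hz
    by_cases h3 : z = N u
    · rw [h3, p1, hσu, hσx] at hz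
      exact hcu (by simpa [hz] using hinv (N u))
    by_cases h4 : z = N (M u)
    · rw [h4, p1, hσv, hσy] at hz
      exact hcv (by simpa [hz] using hinv (N (M u)))
    exact hzν (hνz z h1 h2 h3 h4)

/-- In an extremal intersecting family, `N` can be replaced by a member whose agreement with `p`
is contained in that of both `M` and `N`. -/
lemma exists_mem_agree (hV : Fintype.card V = 2 * k) (hk : 0 < k)
    (hS : ∀ m ∈ S, IsMatchingPerm m) (hint : ∀ m ∈ S, ∀ n ∈ S, ∃ x, m x = n x)
    (hmeet : ∀ F : ZMod (2 * k - 1) → Perm V, IsOneFactorization F → ∃ c, F c ∈ S)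
    {M p : Perm V} (hM : M ∈ S) (hp : p ∈ S) :
    ∀ N ∈ S, ∃ N' ∈ S, ∀ x, N' x = p x → M x = p x ∧ N x = p x := by
  intro N
  induction hd : (Finset.univ.filter fun x => N x = p x ∧ N x ≠ M x).card
    using Nat.strong_induction_on generalizing N with
  | _ d ih =>
    intro hN
    by_cases h : ∃ u, N u = p u ∧ N u ≠ M u
    · obtain ⟨u, hup, huM⟩ := h
      have hmem := swap_conj_mem hV hk hS hint hmeet hM hN huM.symm
      have m1 := (hS M hM).invol
      have m2 := (hS M hM).ne
      have a1 := (hS N hN).invol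
      have a2 := (hS N hN).ne
      have p1 := (hS p hp).invol
      have happ : ∀ z, (swap (M u) (N u) * N * (swap (M u) (N u))⁻¹) z =
        swap (M u) (N u) (N (swap (M u) (N u) z)) := fun z => by simp [swap_inv]
      generalize swap (M u) (N u) * N * (swap (M u) (N u))⁻¹ = N₁ at hmem happ
      have hagree : ∀ z, N₁ z = p z → N₁ z = N z ∧ z ≠ u := by
        intro z hz
        rw [happ] at hz ⊢
        simp only [swap_apply_def] at hz ⊢
        grind
      obtain ⟨N', hN', h'⟩ := ih _ (by
        rw [← hd]
        refine Finset.card_lt_card (Finset.ssubset_iff_of_subset ?_ |>.2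
          ⟨u, Finset.mem_filter.2 ⟨Finset.mem_univ u, hup, huM⟩, ?_⟩)
        · intro z hz
          simp only [Finset.mem_filter, Finset.mem_univ, true_and] at hz ⊢
          have := hagree z hz.1
          grind
        · intro hu
          simp only [Finset.mem_filter, Finset.mem_univ, true_and] at hu
          exact (hagree u hu.1).2 rfl) N₁ rfl hmem
      refine ⟨N', hN', fun x hx => ?_⟩
      have := h' x hx
      have := hagree x this.2
      grind
    · push Not at h
      exact ⟨N, hN, fun x hx => ⟨by rw [← h x hx, hx], hx⟩⟩

lemma exists_common_value (hV : Fintype.card V = 2 * k) (hk : 0 < k)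
    (hS : ∀ m ∈ S, IsMatchingPerm m) (hint : ∀ m ∈ S, ∀ n ∈ S, ∃ x, m x = n x)
    (hmeet : ∀ F : ZMod (2 * k - 1) → Perm V, IsOneFactorization F → ∃ c, F c ∈ S)
    (T : Finset (Perm V)) (hT : T ⊆ S) :
    ∀ M ∈ S, ∀ N ∈ S, ∃ x, M x = N x ∧ ∀ m ∈ T, m x = N x := by
  induction T using Finset.induction_on with
  | empty => simpa using hint
  | insert p T _ ih =>
    intro M hM N hN
    obtain ⟨hp, hT⟩ := Finset.insert_subset_iff.1 hT
    obtain ⟨N', hN', h'⟩ := exists_mem_agree hV hk hS hint hmeet hM hp N hN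
    obtain ⟨x, hx, hx'⟩ := ih hT p hp N' hN'
    obtain ⟨h1, h2⟩ := h' x hx.symm
    refine ⟨x, h1.trans h2.symm, ?_⟩
    simp only [Finset.mem_insert, forall_eq_or_imp]
    exact ⟨h2.symm, fun m hm => (hx' m hm).trans (hx.symm.trans h2.symm)⟩

/-- An intersecting family of `(2k-3)!!` perfect matchings consists of all the matchings
containing a given edge. -/
theorem exists_mem_iff_apply_eq (hV : Fintype.card V = 2 * k) (hk : 2 ≤ k)
    (hS : ∀ m ∈ S, IsMatchingPerm m) (hint : ∀ m ∈ S, ∀ n ∈ S, ∃ x, m x = n x)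
    (hcard : S.card = Nat.doubleFactorial (2 * k - 3)) :
    ∃ x y, x ≠ y ∧ ∀ m, IsMatchingPerm m → (m ∈ S ↔ m x = y) := by
  have hne : Nonempty V := Fintype.card_pos_iff.1 (by omega)
  have : NeZero (2 * k - 1) := ⟨by omega⟩
  have hC : Fintype.card (ZMod (2 * k - 1)) * Nat.doubleFactorial (2 * k - 3) =
      (Finset.univ.filter fun m : Perm V => IsMatchingPerm m).card := by
    rw [card_isMatchingPerm hV (by omega), ZMod.card]
    obtain ⟨j, rfl⟩ : ∃ j, k = j + 2 := ⟨k - 2, by omega⟩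
    rw [show 2 * (j + 2) - 1 = 2 * j + 1 + 2 by omega, show 2 * (j + 2) - 3 = 2 * j + 1 by omega,
      Nat.doubleFactorial_add_two]
  obtain ⟨N, hN⟩ : S.Nonempty := Finset.card_pos.1 (hcard ▸ Nat.doubleFactorial_pos _)
  obtain ⟨x, -, hx⟩ := exists_common_value hV (by omega) hS hint
    (fun F hF => hF.exists_mem_of_card_mul_card_eq hV hS hint (by rw [hcard, hC]) ⟨N, hN⟩)
    S subset_rfl N hN N hN
  refine ⟨x, N x, ((hS N hN).ne x).symm, ?_⟩
  set T := Finset.univ.filter fun m : Perm V => IsMatchingPerm m ∧ m x = N x with hTdef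
  have hmemT : ∀ m, m ∈ T ↔ IsMatchingPerm m ∧ m x = N x := by simp [hTdef]
  have hST : S ⊆ T := fun m hm => (hmemT m).2 ⟨hS m hm, hx m hm⟩
  obtain ⟨F, hF⟩ := exists_isOneFactorization hV (by omega)
  have hle := hF.card_mul_card_le (T := T) hV (fun m hm => ((hmemT m).1 hm).1)
    fun m hm n hn => ⟨x, ((hmemT m).1 hm).2.trans ((hmemT n).1 hn).2.symm⟩
  rw [← hC] at hle
  have hle' := Nat.le_of_mul_le_mul_left hle Fintype.card_pos
  have hEq : S = T := Finset.eq_of_subset_of_card_le hST (by rw [hcard]; exact hle')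
  intro m hm
  rw [hEq, hmemT, and_iff_right hm]

end Extremal

section Edges

variable {k : ℕ}

lemma IsPM.exists_partner {M : Finset (Sym2 (Fin (2 * k)))} (hM : IsPM k M) :
    ∃ m : Perm (Fin (2 * k)), IsMatchingPerm m ∧ ∀ v w, s(v, w) ∈ M ↔ m v = w := by
  have h : ∀ v, ∃ w, ∀ z, s(v, z) ∈ M ↔ w = z := by
    intro v
    obtain ⟨e, ⟨heM, hve⟩, huniq⟩ := hM.2 v
    obtain ⟨w, rfl⟩ := Sym2.mem_iff_exists.1 hve
    refine ⟨w, fun z => ⟨fun hz => ?_, fun hz => hz ▸ heM⟩⟩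
    exact (Sym2.congr_right.1 (huniq _ ⟨hz, Sym2.mem_mk_left v z⟩)).symm
  choose f hf using h
  have hinv : Function.Involutive f := fun v =>
    (hf _ _).1 (Sym2.eq_swap (a := v) (b := f v) ▸ (hf v (f v)).2 rfl)
  refine ⟨hinv.toPerm, ⟨hinv, fun v hv => ?_⟩, hf⟩
  exact hM.1 _ ((hf v v).2 hv) (Sym2.mk_isDiag_iff.2 rfl)

end Edges

/-- for `k ≥ 2`, the characteristic vector (in `ℝ^V`, `V` the set
of perfect matchings of `K_{2k}`) of any intersecting set `S` of perfect
matchings with `|S| = (2k-3)!!` lies in the real span of the characteristic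
vectors of the canonical intersecting sets `S_e` (`e` ranging over the edges of
`K_{2k}`), i.e. in the column space of the perfect matching incidence matrix. -/
theorem stmt_13 (k : ℕ) (hk : 2 ≤ k) (S : Finset (PM k))
    (hS : ∀ M ∈ S, ∀ N ∈ S, ∃ e, e ∈ M.1 ∧ e ∈ N.1)
    (hcard : S.card = Nat.doubleFactorial (2 * k - 3)) :
    (fun M : PM k => if M ∈ S then (1 : ℝ) else 0) ∈
      Submodule.span ℝ
        {v : PM k → ℝ | ∃ e : Sym2 (Fin (2 * k)), ¬ e.IsDiag ∧
          v = fun M : PM k => if e ∈ M.1 then (1 : ℝ) else 0} := by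
  choose Φ hΦ hΦe using fun M : PM k => M.2.exists_partner
  have hinj : Function.Injective Φ := by
    intro M N h
    ext e
    induction e with
    | _ v w => rw [hΦe, hΦe, h]
  obtain ⟨x, y, hxy, h⟩ := exists_mem_iff_apply_eq (S := S.map ⟨Φ, hinj⟩) (by simp) hk
    (by
      simp only [Finset.mem_map, Function.Embedding.coeFn_mk]
      rintro _ ⟨M, -, rfl⟩
      exact hΦ M) (by
      simp only [Finset.mem_map, Function.Embedding.coeFn_mk]
      rintro _ ⟨M, hM, rfl⟩ _ ⟨N, hN, rfl⟩
      obtain ⟨e, heM, heN⟩ := hS M hM N hN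
      induction e with
      | _ v w => exact ⟨v, ((hΦe M v w).1 heM).trans ((hΦe N v w).1 heN).symm⟩)
    (by rw [Finset.card_map, hcard])
  refine Submodule.subset_span ⟨s(x, y), by simpa using hxy, ?_⟩
  funext M
  have hM := h (Φ M) (hΦ M)
  rw [← hΦe] at hM
  simp only [(Finset.mem_map' ⟨Φ, hinj⟩).symm.trans hM]
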